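/- If Λ*(P,Q,D) < ∞, then there exists a probability measure W ∈ W(P,D) with H(W ‖ P×Q) = Λ*(P,Q,D). -/

import Mathlib

open MeasureTheory Filter Set Topology Classical
open scoped ENNReal NNReal

noncomputable section

/-- `-log t` as a value in `ℝ≥0∞` (equal to `∞` when `t = 0`); intended for `t ≤ 1`. -/
def negLog (t : ℝ≥0∞) : ℝ≥0∞ :=
  if t = 0 then ∞ else ENNReal.ofReal (-Real.log t.toReal)

/-- `log t` as a value in `ℝ≥0∞` (equal to `∞` when `t = ∞`); intended for `t ≥ 1`. -/
def posLog (t : ℝ≥0∞) : ℝ≥0∞ :=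
  if t = ∞ then ∞ else ENNReal.ofReal (Real.log t.toReal)

/-- The extended-real-valued logarithm of an `ℝ≥0∞` number. -/
def eLog (t : ℝ≥0∞) : EReal :=
  if t = 0 then ⊥ else if t = ∞ then ⊤ else ((Real.log t.toReal : ℝ) : EReal)

/-- Relative entropy `H(μ‖ν)` (in nats), valued in `ℝ≥0∞`: it equals
`∫ log (dμ/dν) dμ` when `μ ≪ ν` (and `+∞` when this integral is not defined,
which for probability measures can only mean `+∞`), and `+∞` when `¬ μ ≪ ν`. -/
def relEnt {α : Type*} [MeasurableSpace α] (μ ν : Measure α) : ℝ≥0∞ :=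
  if μ ≪ ν ∧ Integrable (llr μ ν) μ then ENNReal.ofReal (∫ x, llr μ ν x ∂μ) else ∞

/-- The set `W(P,D)` of couplings: probability measures on `S × T` with first
marginal `P` and expected distortion at most `D`. -/
def distSet {S T : Type*} [MeasurableSpace S] [MeasurableSpace T]
    (ρ : S × T → ℝ) (P : Measure S) (D : ℝ) : Set (Measure (S × T)) :=
  {W | IsProbabilityMeasure W ∧ W.map Prod.fst = P ∧
    ((∫⁻ z, ENNReal.ofReal (ρ z) ∂W : ℝ≥0∞) : EReal) ≤ ((D : ℝ) : EReal)}

/-- The rate function `R(P,Q,D) = inf_{W ∈ W(P,D)} H(W‖P×Q)` (equal to `+∞`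
when `W(P,D)` is empty). -/
def Rrate {S T : Type*} [MeasurableSpace S] [MeasurableSpace T]
    (ρ : S × T → ℝ) (P : Measure S) (Q : Measure T) (D : ℝ) : ℝ≥0∞ :=
  ⨅ W ∈ distSet ρ P D, relEnt W (P.prod Q)

/-- `Λ(P,Q,λ) = E_X[log E_Y e^{λρ(X,Y)}]`, valued in `EReal`.
For `λ ≥ 0` the integrand lies in `[0,∞]`; for `λ < 0` it lies in `[-∞,0]`. -/
def Lam {S T : Type*} [MeasurableSpace S] [MeasurableSpace T]
    (ρ : S × T → ℝ) (P : Measure S) (Q : Measure T) (l : ℝ) : EReal :=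
  if 0 ≤ l then
    ((∫⁻ x, posLog (∫⁻ y, ENNReal.ofReal (Real.exp (l * ρ (x, y))) ∂Q) ∂P : ℝ≥0∞) : EReal)
  else
    -(((∫⁻ x, negLog (∫⁻ y, ENNReal.ofReal (Real.exp (l * ρ (x, y))) ∂Q) ∂P : ℝ≥0∞) : EReal))

/-- The Fenchel–Legendre transform `Λ*(P,Q,D) = sup_{λ ≤ 0} [λD - Λ(P,Q,λ)]`. -/
def LamStar {S T : Type*} [MeasurableSpace S] [MeasurableSpace T]
    (ρ : S × T → ℝ) (P : Measure S) (Q : Measure T) (D : ℝ) : EReal :=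
  ⨆ l ∈ Iic (0 : ℝ), (((l * D : ℝ) : EReal) - Lam ρ P Q l)

/-- `ρ_Q(x) := essinf_{Y ∼ Q} ρ(x,Y)`. -/
def rhoQ {S T : Type*} [MeasurableSpace T]
    (ρ : S × T → ℝ) (Q : Measure T) (x : S) : ℝ :=
  essInf (fun y => ρ (x, y)) Q

/-- `D_min(P,Q) := inf {D : Λ*(P,Q,D) < ∞}`. -/
def DminPQ {S T : Type*} [MeasurableSpace S] [MeasurableSpace T]
    (ρ : S × T → ℝ) (P : Measure S) (Q : Measure T) : ℝ :=
  sInf {D : ℝ | LamStar ρ P Q D ≠ ⊤}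

/-- `D_ave(P,Q) := E ρ(X,Y)` for independent `X ∼ P`, `Y ∼ Q`, valued in `ℝ≥0∞`. -/
def DavePQ {S T : Type*} [MeasurableSpace S] [MeasurableSpace T]
    (ρ : S × T → ℝ) (P : Measure S) (Q : Measure T) : ℝ≥0∞ :=
  ∫⁻ z, ENNReal.ofReal (ρ z) ∂(P.prod Q)

/-- The candidate derivative `Λ'(λ)` of `Λ(P,Q,·)`. -/
def LamD {S T : Type*} [MeasurableSpace S] [MeasurableSpace T]
    (ρ : S × T → ℝ) (P : Measure S) (Q : Measure T) (l : ℝ) : ℝ :=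
  ∫ x, (∫ y, ρ (x, y) * Real.exp (l * ρ (x, y)) ∂Q) /
    (∫ y, Real.exp (l * ρ (x, y)) ∂Q) ∂P

/-- The left shift on sequences. -/
def shiftSeq {α : Type*} (x : ℕ → α) (n : ℕ) : α := x (n + 1)

/-- The single-letter distortion measure `ρ_n` on `n`-strings. -/
def rhoFin {S T : Type*} (ρ : S × T → ℝ) (n : ℕ) (x : Fin n → S) (y : Fin n → T) : ℝ :=
  (n : ℝ)⁻¹ * ∑ k, ρ (x k, y k)

/-- `L_n(x_1^n, Q^n, D) = -(1/n) log Q^n(B_n(x_1^n,D))`, valued in `ℝ≥0∞`,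
for a memoryless (product) codebook distribution `Q^n`. -/
def LnIID {S T : Type*} [MeasurableSpace T]
    (ρ : S × T → ℝ) (Q : Measure T) (D : ℝ) (n : ℕ) (x : ℕ → S) : ℝ≥0∞ :=
  (n : ℝ≥0∞)⁻¹ *
    negLog ((Measure.pi fun _ : Fin n => Q) {y | rhoFin ρ n (fun k => x k) y ≤ D})

/-- The empirical distribution `P_{x_1^n} = (1/n) ∑_{k=1}^n δ_{x_k}`. -/
def empMeas {S : Type*} [MeasurableSpace S] (n : ℕ) (x : ℕ → S) : Measure S :=
  (n : ℝ≥0∞)⁻¹ • ∑ k ∈ Finset.range n, Measure.dirac (x k)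

/-- The `n`-dimensional marginal of a measure on sequences. -/
def margN {α : Type*} [MeasurableSpace α] (μ : Measure (ℕ → α)) (n : ℕ) :
    Measure (Fin n → α) :=
  μ.map fun x (k : Fin n) => x (k : ℕ)

/-- The strong mixing condition `C⁻¹ 𝒬(A) 𝒬(B) ≤ 𝒬(A ∩ B) ≤ C 𝒬(A) 𝒬(B)` for all
`A ∈ σ(Y_1^n)`, `B ∈ σ(Y_{n+1}^∞)` and all `n`. -/
def Mixing {T : Type*} [MeasurableSpace T] (𝒬 : Measure (ℕ → T)) (C : ℝ) : Prop :=
  ∀ (n : ℕ) (A B : Set (ℕ → T)),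
    MeasurableSet[MeasurableSpace.comap (fun y (k : Fin n) => y (k : ℕ)) inferInstance] A →
    MeasurableSet[MeasurableSpace.comap (fun y (k : ℕ) => y (k + n)) inferInstance] B →
    (ENNReal.ofReal C)⁻¹ * (𝒬 A * 𝒬 B) ≤ 𝒬 (A ∩ B) ∧
      𝒬 (A ∩ B) ≤ ENNReal.ofReal C * (𝒬 A * 𝒬 B)

/-- `L_n(x_1^n, Q_n, D) = -(1/n) log Q_n(B_n(x_1^n,D))` where `Q_n` is the
`n`-dimensional marginal of the codebook process law `𝒬`. -/
def LnMem {S T : Type*} [MeasurableSpace T]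
    (ρ : S × T → ℝ) (𝒬 : Measure (ℕ → T)) (D : ℝ) (n : ℕ) (x : ℕ → S) : ℝ≥0∞ :=
  (n : ℝ≥0∞)⁻¹ * negLog (margN 𝒬 n {y | rhoFin ρ n (fun k => x k) y ≤ D})

/-- The set `W_n(P_n,D)` of couplings on `S^n × T^n`. -/
def distSetN {S T : Type*} [MeasurableSpace S] [MeasurableSpace T]
    (ρ : S × T → ℝ) (n : ℕ) (Pn : Measure (Fin n → S)) (D : ℝ) :
    Set (Measure ((Fin n → S) × (Fin n → T))) :=
  {W | IsProbabilityMeasure W ∧ W.map Prod.fst = Pn ∧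
    ((∫⁻ z, ENNReal.ofReal (rhoFin ρ n z.1 z.2) ∂W : ℝ≥0∞) : EReal) ≤ ((D : ℝ) : EReal)}

/-- `R_n(P_n,Q_n,D) = (1/n) inf_{W_n ∈ W_n(P_n,D)} H(W_n‖P_n×Q_n)`. -/
def RnMem {S T : Type*} [MeasurableSpace S] [MeasurableSpace T]
    (ρ : S × T → ℝ) (n : ℕ) (Pn : Measure (Fin n → S)) (Qn : Measure (Fin n → T))
    (D : ℝ) : ℝ≥0∞ :=
  (n : ℝ≥0∞)⁻¹ * ⨅ W ∈ distSetN ρ n Pn D, relEnt W (Pn.prod Qn)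

/-- `Λ_n(P_n,Q_n,λ) = E_{X_1^n}[log E_{Y_1^n} e^{λ ρ_n(X_1^n,Y_1^n)}]`. -/
def LamN {S T : Type*} [MeasurableSpace S] [MeasurableSpace T]
    (ρ : S × T → ℝ) (n : ℕ) (Pn : Measure (Fin n → S)) (Qn : Measure (Fin n → T))
    (l : ℝ) : EReal :=
  Lam (fun z => rhoFin ρ n z.1 z.2) Pn Qn l

/-- `Λ_n*(P_n,Q_n,D) = (1/n) sup_{λ ≤ 0} [λD - Λ_n(P_n,Q_n,λ)]`. -/
def LamStarN {S T : Type*} [MeasurableSpace S] [MeasurableSpace T]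
    (ρ : S × T → ℝ) (n : ℕ) (Pn : Measure (Fin n → S)) (Qn : Measure (Fin n → T))
    (D : ℝ) : EReal :=
  (((n : ℝ)⁻¹ : ℝ) : EReal) *
    ⨆ l ∈ Iic (0 : ℝ), (((l * D : ℝ) : EReal) - LamN ρ n Pn Qn l)

/-- One-sided Fenchel–Legendre transform `D ↦ sup_{λ ≤ 0} [λD - Λ(λ)]` of a
function `Λ : ℝ → EReal`. -/
def FLT (L : ℝ → EReal) (D : ℝ) : EReal :=
  ⨆ l ∈ Iic (0 : ℝ), (((l * D : ℝ) : EReal) - L l)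


/-- `a(t) = -log E exp(-tX)`. -/
def aFn {T : Type*} [MeasurableSpace T] (X : T → ℝ) (Q : Measure T) (t : ℝ) : ℝ :=
  -Real.log (∫ y, Real.exp (-t * X y) ∂Q)

section Pointwise

variable {T : Type*} [MeasurableSpace T] {X : T → ℝ} {Q : Measure T} [IsProbabilityMeasure Q]

lemma pt_int (hX : Measurable X) (h0 : ∀ y, 0 ≤ X y) {t : ℝ} (ht : 0 ≤ t) :
    Integrable (fun y => Real.exp (-t * X y)) Q := by
  refine Integrable.of_bound (C := 1) (by fun_prop) (ae_of_all _ fun y => ?_)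
  rw [Real.norm_eq_abs, abs_of_pos (Real.exp_pos _)]
  apply Real.exp_le_one_iff.2
  nlinarith [h0 y]

lemma pt_pos (hX : Measurable X) (h0 : ∀ y, 0 ≤ X y) {t : ℝ} (ht : 0 ≤ t) :
    0 < ∫ y, Real.exp (-t * X y) ∂Q :=
  integral_exp_pos (pt_int hX h0 ht)

lemma pt_exp (hX : Measurable X) (h0 : ∀ y, 0 ≤ X y) {t : ℝ} (ht : 0 ≤ t) :
    Real.exp (-aFn X Q t) = ∫ y, Real.exp (-t * X y) ∂Q := by
  rw [aFn, neg_neg, Real.exp_log (pt_pos hX h0 ht)]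

lemma pt_zero : aFn X Q 0 = 0 := by simp [aFn]

lemma pt_mono (hX : Measurable X) (h0 : ∀ y, 0 ≤ X y) {s t : ℝ} (hs : 0 ≤ s) (hst : s ≤ t) :
    aFn X Q s ≤ aFn X Q t := by
  unfold aFn
  apply neg_le_neg
  apply Real.log_le_log (pt_pos hX h0 (hs.trans hst))
  apply integral_mono (pt_int hX h0 (hs.trans hst)) (pt_int hX h0 hs)
  intro y
  apply Real.exp_le_exp.2
  nlinarith [h0 y]

lemma pt_nonneg (hX : Measurable X) (h0 : ∀ y, 0 ≤ X y) {t : ℝ} (ht : 0 ≤ t) :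
    0 ≤ aFn X Q t := by
  have := pt_mono (Q := Q) hX h0 le_rfl ht
  rwa [pt_zero] at this

lemma pt_anti (hX : Measurable X) (h0 : ∀ y, 0 ≤ X y) {s t : ℝ} (hs : 0 < s) (hst : s ≤ t) :
    aFn X Q t / t ≤ aFn X Q s / s := by
  have ht : 0 < t := hs.trans_le hst
  have hp : 1 ≤ t / s := (one_le_div hs).2 hst
  have hpw : ∀ y, (Real.exp (-s * X y)) ^ (t / s) = Real.exp (-t * X y) := by
    intro y
    rw [← Real.exp_mul]
    congr 1
    field_simp
  have h := (convexOn_rpow hp).map_integral_le (μ := Q) (f := fun y => Real.exp (-s * X y))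
    (by exact (Real.continuous_rpow_const (by positivity)).continuousOn) isClosed_Ici
    (ae_of_all _ fun y => (Real.exp_pos _).le) (pt_int hX h0 hs.le)
    (by
      have : ((fun x : ℝ => x ^ (t / s)) ∘ fun y => Real.exp (-s * X y))
        = fun y => Real.exp (-t * X y) := funext hpw
      rw [this]; exact pt_int hX h0 ht.le)
  simp only [hpw] at h
  have h2 := Real.log_le_log (Real.rpow_pos_of_pos (pt_pos hX h0 hs.le) _) h
  rw [Real.log_rpow (pt_pos hX h0 hs.le)] at h2
  unfold aFn
  rw [div_le_div_iff₀ ht hs]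
  rw [div_mul_eq_mul_div, div_le_iff₀ hs] at h2
  nlinarith

lemma pt_interior (hX : Measurable X) (h0 : ∀ y, 0 ≤ X y) {t : ℝ} (ht : 0 < t) :
    -t ∈ interior (ProbabilityTheory.integrableExpSet X Q) := by
  rw [mem_interior_iff_mem_nhds]
  filter_upwards [Iio_mem_nhds (show -t < 0 by linarith)] with v hv
  have := pt_int (Q := Q) hX h0 (t := -v) (by have : v < 0 := hv; linarith)
  simpa [ProbabilityTheory.integrableExpSet] using this

lemma pt_intX (hX : Measurable X) (h0 : ∀ y, 0 ≤ X y) {t : ℝ} (ht : 0 < t) :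
    Integrable (fun y => X y * Real.exp (-t * X y)) Q := by
  have := ProbabilityTheory.integrable_pow_mul_exp_of_mem_interior_integrableExpSet
    (pt_interior (Q := Q) hX h0 ht) 1
  simpa using this

lemma pt_deriv (hX : Measurable X) (h0 : ∀ y, 0 ≤ X y) {t : ℝ} (ht : 0 < t) :
    HasDerivAt (aFn X Q)
      ((∫ y, X y * Real.exp (-t * X y) ∂Q) / ∫ y, Real.exp (-t * X y) ∂Q) t := by
  have h := ProbabilityTheory.hasDerivAt_mgf (pt_interior (Q := Q) hX h0 ht)
  have h2 := h.comp t (hasDerivAt_neg t)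
  have h3 := (h2.log (pt_pos hX h0 ht.le).ne').neg
  have e : (∫ y, X y * Real.exp (-t * X y) ∂Q) / (∫ y, Real.exp (-t * X y) ∂Q)
      = -((∫ y, X y * Real.exp (-t * X y) ∂Q) * -1 / (∫ y, Real.exp (-t * X y) ∂Q)) := by ring
  rw [e]
  exact h3

lemma pt_deriv_le (hX : Measurable X) (h0 : ∀ y, 0 ≤ X y) {t : ℝ} (ht : 0 < t) :
    (∫ y, X y * Real.exp (-t * X y) ∂Q) / (∫ y, Real.exp (-t * X y) ∂Q) ≤ aFn X Q t / t := by
  have hG := pt_pos (Q := Q) hX h0 ht.le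
  set G := ∫ y, Real.exp (-t * X y) ∂Q with hGdef
  have key : ∫ y, t * (X y * Real.exp (-t * X y)) ∂Q
      ≤ ∫ y, (G - (1 - aFn X Q t) * Real.exp (-t * X y)) ∂Q := by
    apply integral_mono ((pt_intX hX h0 ht).const_mul _)
      ((integrable_const _).sub ((pt_int hX h0 ht.le).const_mul _))
    intro y
    have hu := Real.exp_pos (-t * X y)
    have h1 := Real.add_one_le_exp (-aFn X Q t + t * X y)
    have h2 : Real.exp (-aFn X Q t + t * X y) * Real.exp (-t * X y) = G := by
      rw [← Real.exp_add, hGdef, ← pt_exp hX h0 ht.le]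
      congr 1; ring
    have h3 := mul_le_mul_of_nonneg_right h1 hu.le
    rw [h2] at h3
    change t * (X y * Real.exp (-t * X y)) ≤ G - (1 - aFn X Q t) * Real.exp (-t * X y)
    nlinarith
  rw [integral_const_mul, integral_sub (integrable_const _) ((pt_int hX h0 ht.le).const_mul _),
    integral_const_mul, ← hGdef] at key
  simp only [integral_const, probReal_univ, one_smul] at key
  rw [div_le_div_iff₀ hG ht]
  nlinarith

lemma pt_deriv_nonneg (h0 : ∀ y, 0 ≤ X y) (t : ℝ) :
    0 ≤ (∫ y, X y * Real.exp (-t * X y) ∂Q) / (∫ y, Real.exp (-t * X y) ∂Q) :=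
  div_nonneg (integral_nonneg fun y => mul_nonneg (h0 y) (Real.exp_pos _).le)
    (integral_nonneg fun _ => (Real.exp_pos _).le)

lemma pt_cont (hX : Measurable X) (h0 : ∀ y, 0 ≤ X y) : ContinuousOn (aFn X Q) (Ici 0) := by
  unfold aFn
  refine (ContinuousOn.log ?_ fun t ht => (pt_pos hX h0 ht).ne').neg
  refine continuousOn_of_dominated (bound := fun _ => 1) (fun t _ => by fun_prop) ?_
    (integrable_const _) (ae_of_all _ fun y => by fun_prop)
  intro t ht
  refine ae_of_all _ fun y => ?_
  rw [Real.norm_eq_abs, abs_of_pos (Real.exp_pos _)]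
  apply Real.exp_le_one_iff.2
  nlinarith [h0 y, mem_Ici.1 ht]

/-- the essential infimum of `X`, as a limit. -/
def rFn {T : Type*} [MeasurableSpace T] (X : T → ℝ) (Q : Measure T) : ℝ :=
  ⨅ n : ℕ, aFn X Q ((n : ℝ) + 1) / ((n : ℝ) + 1)

lemma pt_bdd (hX : Measurable X) (h0 : ∀ y, 0 ≤ X y) :
    BddBelow (range fun n : ℕ => aFn X Q ((n : ℝ) + 1) / ((n : ℝ) + 1)) := by
  refine ⟨0, ?_⟩
  rintro _ ⟨n, rfl⟩
  exact div_nonneg (pt_nonneg hX h0 (by positivity)) (by positivity)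

lemma pt_r_tendsto (hX : Measurable X) (h0 : ∀ y, 0 ≤ X y) :
    Tendsto (fun n : ℕ => aFn X Q ((n : ℝ) + 1) / ((n : ℝ) + 1)) atTop (𝓝 (rFn X Q)) := by
  refine tendsto_atTop_ciInf ?_ (pt_bdd hX h0)
  intro m n hmn
  apply pt_anti hX h0 (by positivity)
  have : (m : ℝ) ≤ n := by exact_mod_cast hmn
  linarith

lemma pt_r_nonneg (hX : Measurable X) (h0 : ∀ y, 0 ≤ X y) : 0 ≤ rFn X Q :=
  le_ciInf fun n => div_nonneg (pt_nonneg hX h0 (by positivity)) (by positivity)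

lemma pt_r_le (hX : Measurable X) (h0 : ∀ y, 0 ≤ X y) (n : ℕ) :
    ((n : ℝ) + 1) * rFn X Q ≤ aFn X Q ((n : ℝ) + 1) := by
  have := ciInf_le (pt_bdd (Q := Q) hX h0) n
  have h2 : (0 : ℝ) < (n : ℝ) + 1 := by positivity
  have h3 : rFn X Q ≤ aFn X Q ((n : ℝ) + 1) / ((n : ℝ) + 1) := this
  rw [le_div_iff₀ h2] at h3
  linarith

lemma pt_r_ae (hX : Measurable X) (h0 : ∀ y, 0 ≤ X y) : ∀ᵐ y ∂Q, rFn X Q ≤ X y := by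
  have hz : ∀ e < rFn X Q, Q {y | X y ≤ e} = 0 := by
    intro e he
    have hb : ∀ n : ℕ, Q.real {y | X y ≤ e} ≤ (Real.exp (-(rFn X Q - e))) ^ n := by
      intro n
      rcases n with _ | n
      · simp [measureReal_le_one]
      have h := ProbabilityTheory.measure_le_le_exp_cgf (μ := Q) (X := X) (t := -((n : ℝ) + 1)) e
        (by have : (0 : ℝ) ≤ n := by positivity
            linarith) (pt_int hX h0 (by positivity))
      refine h.trans ?_
      rw [← Real.exp_nat_mul]
      apply Real.exp_le_exp.2
      have h4 := pt_r_le (Q := Q) hX h0 n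
      have h5 : ProbabilityTheory.cgf X Q (-((n : ℝ) + 1)) = - aFn X Q ((n : ℝ) + 1) := by
        simp [aFn, ProbabilityTheory.cgf, ProbabilityTheory.mgf]
      rw [h5]
      push_cast
      nlinarith
    have hl : Tendsto (fun n : ℕ => (Real.exp (-(rFn X Q - e))) ^ n) atTop (𝓝 0) :=
      tendsto_pow_atTop_nhds_zero_of_lt_one (Real.exp_pos _).le
        (by rw [Real.exp_lt_one_iff]; linarith)
    have := ge_of_tendsto' hl hb
    have h6 : Q.real {y | X y ≤ e} = 0 := le_antisymm this measureReal_nonneg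
    exact (measureReal_eq_zero_iff).1 h6
  have hall : ∀ᵐ y ∂Q, ∀ k : ℕ, ¬ X y ≤ rFn X Q - 1 / ((k : ℝ) + 1) := by
    rw [ae_all_iff]
    intro k
    have := hz (rFn X Q - 1 / ((k : ℝ) + 1)) (by
      have : (0 : ℝ) < 1 / ((k : ℝ) + 1) := by positivity
      linarith)
    rw [ae_iff]
    simpa using this
  filter_upwards [hall] with y hy
  by_contra hlt
  push Not at hlt
  obtain ⟨k, hk⟩ := exists_nat_one_div_lt (sub_pos.2 hlt)
  exact hy k (by linarith)

lemma pt_lim (hX : Measurable X) (h0 : ∀ y, 0 ≤ X y) :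
    Tendsto (fun n : ℕ => Real.exp (-(aFn X Q ((n : ℝ) + 1) - ((n : ℝ) + 1) * rFn X Q))) atTop
      (𝓝 (Q.real {y | X y = rFn X Q})) := by
  have hm : MeasurableSet {y | X y = rFn X Q} := hX (measurableSet_singleton _)
  have he : ∀ n : ℕ, Real.exp (-(aFn X Q ((n : ℝ) + 1) - ((n : ℝ) + 1) * rFn X Q))
      = ∫ y, Real.exp (-((n : ℝ) + 1) * (X y - rFn X Q)) ∂Q := by
    intro n
    have : -(aFn X Q ((n : ℝ) + 1) - ((n : ℝ) + 1) * rFn X Q)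
      = (-(aFn X Q ((n : ℝ) + 1))) + ((n : ℝ) + 1) * rFn X Q := by ring
    rw [this, Real.exp_add, pt_exp hX h0 (by positivity), ← integral_mul_const]
    congr 1
    ext y
    rw [← Real.exp_add]
    congr 1
    ring
  simp_rw [he]
  rw [← integral_indicator_one hm]
  refine tendsto_integral_of_dominated_convergence (fun _ => 1) (fun n => by fun_prop)
    (integrable_const _) ?_ ?_
  · intro n
    filter_upwards [pt_r_ae (Q := Q) hX h0] with y hy
    rw [Real.norm_eq_abs, abs_of_pos (Real.exp_pos _)]
    apply Real.exp_le_one_iff.2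
    have : (0 : ℝ) ≤ n := by positivity
    nlinarith
  · filter_upwards [pt_r_ae (Q := Q) hX h0] with y hy
    by_cases hyr : X y = rFn X Q
    · simp [hyr, indicator]
    · have hlt : 0 < X y - rFn X Q := sub_pos.2 (lt_of_le_of_ne hy (Ne.symm hyr))
      have : y ∉ {y | X y = rFn X Q} := hyr
      rw [indicator_of_notMem this]
      apply Real.tendsto_exp_atBot.comp
      have h1 : Tendsto (fun n : ℕ => ((n : ℝ) + 1)) atTop atTop :=
        tendsto_atTop_add_const_right _ _ tendsto_natCast_atTop_atTop
      have h2 := (h1.atTop_mul_const hlt)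
      have h3 := tendsto_neg_atTop_atBot.comp h2
      refine h3.congr fun n => ?_
      simp only [Function.comp]
      ring

lemma pt_upper (hX : Measurable X) (h0 : ∀ y, 0 ≤ X y)
    (hq : 0 < Q.real {y | X y = rFn X Q}) {t : ℝ} (ht : 0 ≤ t) :
    aFn X Q t ≤ t * rFn X Q + -Real.log (Q.real {y | X y = rFn X Q}) := by
  have hm : MeasurableSet {y | X y = rFn X Q} := hX (measurableSet_singleton _)
  have h1 : Q.real {y | X y = rFn X Q} * Real.exp (-t * rFn X Q)
      ≤ ∫ y, Real.exp (-t * X y) ∂Q := by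
    rw [← integral_indicator_one hm, ← integral_mul_const]
    apply integral_mono
      (((integrable_const (1 : ℝ)).indicator hm).mul_const _) (pt_int hX h0 ht)
    intro y
    by_cases hy : X y = rFn X Q
    · simp [indicator, hy]
    · simp [indicator, hy, (Real.exp_pos _).le]
  have h2 := Real.log_le_log (by positivity) h1
  rw [Real.log_mul hq.ne' (Real.exp_pos _).ne', Real.log_exp] at h2
  unfold aFn
  linarith

end Pointwise

section Prod

variable {S T : Type*} [MeasurableSpace S] [MeasurableSpace T]
  {ρ : S × T → ℝ} {P : Measure S} {Q : Measure T} [IsProbabilityMeasure P] [IsProbabilityMeasure Q]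

lemma sec_meas (hρm : Measurable ρ) (x : S) : Measurable fun y => ρ (x, y) :=
  hρm.comp measurable_prodMk_left

lemma a_meas (hρm : Measurable ρ) (t : ℝ) :
    Measurable fun x => aFn (fun y => ρ (x, y)) Q t := by
  unfold aFn
  have h : StronglyMeasurable fun z : S × T => Real.exp (-t * ρ z) :=
    (by fun_prop : Measurable fun z : S × T => Real.exp (-t * ρ z)).stronglyMeasurable
  exact (Real.measurable_log.comp (h.integral_prod_right' (ν := Q)).measurable).neg

lemma r_meas (hρm : Measurable ρ) : Measurable fun x => rFn (fun y => ρ (x, y)) Q := by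
  unfold rFn
  exact Measurable.iInf fun n => (a_meas hρm _).div_const _

lemma constr {f : S × T → ℝ} (hf : Measurable f) (hf0 : ∀ z, 0 ≤ f z)
    (h1 : ∀ᵐ x ∂P, ∫⁻ y, ENNReal.ofReal (f (x, y)) ∂Q = 1) :
    ∃ W : Measure (S × T), W = (P.prod Q).withDensity (fun z => ENNReal.ofReal (f z)) ∧
      IsProbabilityMeasure W ∧ W.map Prod.fst = P ∧
      (∀ g : S × T → ℝ≥0∞, Measurable g →
        ∫⁻ z, g z ∂W = ∫⁻ x, ∫⁻ y, ENNReal.ofReal (f (x, y)) * g (x, y) ∂Q ∂P) ∧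
      ∀ h : S × T → ℝ, (∀ᵐ z ∂W, Real.log (f z) = h z) → Integrable h W →
        relEnt W (P.prod Q) = ENNReal.ofReal (∫ z, h z ∂W) := by
  have hfm : Measurable fun z => ENNReal.ofReal (f z) := hf.ennreal_ofReal
  have hmap : ((P.prod Q).withDensity (fun z => ENNReal.ofReal (f z))).map Prod.fst = P := by
    ext s hs
    rw [Measure.map_apply measurable_fst hs, withDensity_apply _ (measurable_fst hs),
      ← lintegral_indicator (measurable_fst hs),
      lintegral_prod _ (hfm.indicator (measurable_fst hs)).aemeasurable]
    have : ∀ᵐ x ∂P, (∫⁻ y, (Prod.fst ⁻¹' s).indicator (fun z => ENNReal.ofReal (f z)) (x, y) ∂Q)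
        = s.indicator 1 x := by
      filter_upwards [h1] with x hx
      by_cases hxs : x ∈ s
      · simp [indicator, hxs, hx]
      · simp [indicator, hxs]
    rw [lintegral_congr_ae this, lintegral_indicator_one hs]
  have hprob : IsProbabilityMeasure
      ((P.prod Q).withDensity (fun z => ENNReal.ofReal (f z))) := by
    constructor
    have := congrArg (fun m => m univ) hmap
    simpa [Measure.map_apply measurable_fst MeasurableSet.univ] using this
  refine ⟨_, rfl, hprob, hmap, ?_, ?_⟩
  · intro g hg
    rw [lintegral_withDensity_eq_lintegral_mul _ hfm hg,
      lintegral_prod _ (hfm.mul hg).aemeasurable]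
    rfl
  · intro h hh hi
    have hac := withDensity_absolutelyContinuous (P.prod Q) (fun z => ENNReal.ofReal (f z))
    have hae : llr ((P.prod Q).withDensity (fun z => ENNReal.ofReal (f z))) (P.prod Q)
        =ᵐ[(P.prod Q).withDensity (fun z => ENNReal.ofReal (f z))] h := by
      filter_upwards [hh, hac.ae_le (Measure.rnDeriv_withDensity (P.prod Q) hfm)] with z hz hz2
      rw [llr, hz2, ENNReal.toReal_ofReal (hf0 z), hz]
    rw [relEnt, if_pos ⟨hac, hi.congr hae.symm⟩, integral_congr_ae hae]

lemma Lam_neg (hρm : Measurable ρ) (hρ0 : ∀ z, 0 ≤ ρ z) {t : ℝ} (ht : 0 ≤ t) :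
    Lam ρ P Q (-t) =
      -((∫⁻ x, ENNReal.ofReal (aFn (fun y => ρ (x, y)) Q t) ∂P : ℝ≥0∞) : EReal) := by
  rcases ht.eq_or_lt with rfl | ht
  · simp [Lam, posLog, pt_zero]
  · rw [Lam, if_neg (by linarith)]
    congr 2
    apply lintegral_congr
    intro x
    have hi := pt_int (Q := Q) (sec_meas hρm x) (fun y => hρ0 (x, y)) ht.le
    have hp := pt_pos (Q := Q) (sec_meas hρm x) (fun y => hρ0 (x, y)) ht.le
    rw [← ofReal_integral_eq_lintegral_ofReal hi (ae_of_all _ fun _ => (Real.exp_pos _).le)]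
    rw [negLog, if_neg (by simpa using hp), ENNReal.toReal_ofReal hp.le, aFn]

lemma lamstar_lub (hρm : Measurable ρ) (hρ0 : ∀ z, 0 ≤ ρ z) {D : ℝ}
    (hfin : LamStar ρ P Q D ≠ ⊤) :
    ∃ M : ℝ, LamStar ρ P Q D = (M : EReal) ∧
      (∀ t, 0 ≤ t → Integrable (fun x => aFn (fun y => ρ (x, y)) Q t) P) ∧
      IsLUB ((fun t => (∫ x, aFn (fun y => ρ (x, y)) Q t ∂P) - t * D) '' Ici 0) M := by
  have hle : ∀ t, 0 ≤ t → (((-t) * D : ℝ) : EReal) - Lam ρ P Q (-t) ≤ LamStar ρ P Q D := by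
    intro t ht
    exact le_iSup₂ (f := fun (l : ℝ) (_ : l ∈ Iic (0 : ℝ)) =>
      (((l * D : ℝ) : EReal) - Lam ρ P Q l)) (-t) (by simpa using ht)
  have hint : ∀ t, 0 ≤ t → Integrable (fun x => aFn (fun y => ρ (x, y)) Q t) P := by
    intro t ht
    have h1 := hle t ht
    rw [Lam_neg hρm hρ0 ht] at h1
    rw [← lintegral_ofReal_ne_top_iff_integrable (a_meas hρm t).aestronglyMeasurable
      (ae_of_all _ fun x => pt_nonneg (sec_meas hρm x) (fun y => hρ0 (x, y)) ht)]
    intro htop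
    rw [htop] at h1
    apply hfin
    rw [← top_le_iff]
    refine le_trans ?_ h1
    rw [sub_eq_add_neg, neg_neg, EReal.coe_ennreal_top, EReal.coe_add_top]
  have hval : ∀ t, 0 ≤ t → (((-t) * D : ℝ) : EReal) - Lam ρ P Q (-t)
      = (((∫ x, aFn (fun y => ρ (x, y)) Q t ∂P) - t * D : ℝ) : EReal) := by
    intro t ht
    have hnn : ∀ x, 0 ≤ aFn (fun y => ρ (x, y)) Q t :=
      fun x => pt_nonneg (sec_meas hρm x) (fun y => hρ0 (x, y)) ht
    rw [Lam_neg hρm hρ0 ht,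
      ← ofReal_integral_eq_lintegral_ofReal (hint t ht) (ae_of_all _ hnn),
      EReal.coe_ennreal_ofReal, max_eq_left (integral_nonneg hnn), ← EReal.coe_neg,
      ← EReal.coe_sub]
    congr 1
    ring
  have hbot : LamStar ρ P Q D ≠ ⊥ := by
    intro hb
    have h1 := hle 0 le_rfl
    rw [hval 0 le_rfl, hb] at h1
    exact absurd (le_bot_iff.1 h1) (EReal.coe_ne_bot _)
  refine ⟨(LamStar ρ P Q D).toReal, (EReal.coe_toReal hfin hbot).symm, hint, ?_, ?_⟩
  · rintro _ ⟨t, ht, rfl⟩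
    have h1 := hle t ht
    rw [hval t ht, ← EReal.coe_toReal hfin hbot] at h1
    exact EReal.coe_le_coe_iff.1 h1
  · intro b hb
    rw [← EReal.coe_le_coe_iff, EReal.coe_toReal hfin hbot]
    refine iSup₂_le fun l hl => ?_
    have hl' : 0 ≤ -l := by simpa using hl
    have h2 := hval (-l) hl'
    rw [neg_neg] at h2
    rw [h2]
    exact EReal.coe_le_coe_iff.2 (hb ⟨-l, hl', rfl⟩)

/-- Tilted coupling at an interior optimum. -/
lemma case_pos (hρm : Measurable ρ) (hρ0 : ∀ z, 0 ≤ ρ z) {D : ℝ}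
    (hint : ∀ t, 0 ≤ t → Integrable (fun x => aFn (fun y => ρ (x, y)) Q t) P)
    {t : ℝ} (ht : 0 < t)
    (hmax : ∀ s, 0 ≤ s → (∫ x, aFn (fun y => ρ (x, y)) Q s ∂P) - s * D
      ≤ (∫ x, aFn (fun y => ρ (x, y)) Q t ∂P) - t * D) :
    ∃ W ∈ distSet ρ P D, relEnt W (P.prod Q)
      = ENNReal.ofReal ((∫ x, aFn (fun y => ρ (x, y)) Q t ∂P) - t * D) := by
  set a' : ℝ → S → ℝ := fun s x => (∫ y, ρ (x, y) * Real.exp (-s * ρ (x, y)) ∂Q) /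
    (∫ y, Real.exp (-s * ρ (x, y)) ∂Q) with ha'
  have ha'm : Measurable (a' t) := by
    have h1 : StronglyMeasurable fun z : S × T => Real.exp (-t * ρ z) :=
      (by fun_prop : Measurable fun z : S × T => Real.exp (-t * ρ z)).stronglyMeasurable
    have h2 : StronglyMeasurable fun z : S × T => ρ z * Real.exp (-t * ρ z) :=
      (by fun_prop : Measurable fun z : S × T => ρ z * Real.exp (-t * ρ z)).stronglyMeasurable
    exact (h2.integral_prod_right' (ν := Q)).measurable.div
      (h1.integral_prod_right' (ν := Q)).measurable
  have hpos : ∀ s ∈ Ioi (t / 2), 0 < s := fun s hs => lt_trans (by positivity) (mem_Ioi.1 hs)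
  obtain ⟨ha'i, hd⟩ := hasDerivAt_integral_of_dominated_loc_of_deriv_le (μ := P)
    (F := fun s x => aFn (fun y => ρ (x, y)) Q s) (F' := a') (x₀ := t) (s := Ioi (t / 2))
    (bound := fun x => aFn (fun y => ρ (x, y)) Q (t / 2) / (t / 2))
    (Ioi_mem_nhds (by linarith)) (Eventually.of_forall fun s => (a_meas hρm s).aestronglyMeasurable)
    (hint t ht.le) ha'm.aestronglyMeasurable
    (ae_of_all _ fun x s hs => by
      rw [Real.norm_eq_abs, abs_of_nonneg (pt_deriv_nonneg (fun y => hρ0 (x, y)) s)]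
      exact (pt_deriv_le (sec_meas hρm x) (fun y => hρ0 (x, y)) (hpos s hs)).trans
        (pt_anti (sec_meas hρm x) (fun y => hρ0 (x, y)) (by positivity) (le_of_lt hs)))
    ((hint (t / 2) (by positivity)).div_const _)
    (ae_of_all _ fun x s hs => pt_deriv (sec_meas hρm x) (fun y => hρ0 (x, y)) (hpos s hs))
  have hD : ∫ x, a' t x ∂P = D := by
    have h2 := hd.sub ((hasDerivAt_id t).mul_const D)
    have h3 : IsLocalMax (fun s => (∫ x, aFn (fun y => ρ (x, y)) Q s ∂P) - s * D) t := by
      filter_upwards [Ioi_mem_nhds ht] with s hs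
      exact hmax s (le_of_lt hs)
    have h4 := h3.hasDerivAt_eq_zero h2
    linarith
  have ha'0 : ∀ x, 0 ≤ a' t x := fun x => pt_deriv_nonneg (fun y => hρ0 (x, y)) t
  have hD0 : 0 ≤ D := hD ▸ integral_nonneg ha'0
  set f : S × T → ℝ := fun z => Real.exp (-t * ρ z + aFn (fun y => ρ (z.1, y)) Q t) with hf
  have hfm : Measurable f := by
    have : Measurable fun z : S × T => aFn (fun y => ρ (z.1, y)) Q t :=
      (a_meas (Q := Q) hρm t).comp measurable_fst
    exact ((hρm.const_mul (-t)).add this).exp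
  have hGa : ∀ x, Real.exp (aFn (fun y => ρ (x, y)) Q t)
      = (∫ y, Real.exp (-t * ρ (x, y)) ∂Q)⁻¹ := by
    intro x
    rw [← pt_exp (sec_meas hρm x) (fun y => hρ0 (x, y)) ht.le, Real.exp_neg, inv_inv]
  have h1 : ∀ x, ∫⁻ y, ENNReal.ofReal (f (x, y)) ∂Q = 1 := by
    intro x
    have hi := pt_int (Q := Q) (sec_meas hρm x) (fun y => hρ0 (x, y)) ht.le
    have hp := pt_pos (Q := Q) (sec_meas hρm x) (fun y => hρ0 (x, y)) ht.le
    have : ∀ y, f (x, y) = Real.exp (-t * ρ (x, y)) * Real.exp (aFn (fun y => ρ (x, y)) Q t) :=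
      fun y => Real.exp_add _ _
    simp_rw [this]
    rw [← ofReal_integral_eq_lintegral_ofReal (hi.mul_const _)
      (ae_of_all _ fun _ => by positivity), integral_mul_const, hGa, mul_inv_cancel₀ hp.ne',
      ENNReal.ofReal_one]
  obtain ⟨W, -, hWp, hWm, hWl, hWe⟩ := constr (P := P) (Q := Q) hfm
    (fun z => (Real.exp_pos _).le) (ae_of_all _ h1)
  have hρW : ∫⁻ z, ENNReal.ofReal (ρ z) ∂W = ENNReal.ofReal D := by
    rw [hWl _ hρm.ennreal_ofReal, ← hD,
      ofReal_integral_eq_lintegral_ofReal ha'i (ae_of_all _ ha'0)]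
    apply lintegral_congr
    intro x
    have hi := pt_intX (Q := Q) (sec_meas hρm x) (fun y => hρ0 (x, y)) ht
    have : ∀ y, ENNReal.ofReal (f (x, y)) * ENNReal.ofReal (ρ (x, y)) =
        ENNReal.ofReal ((ρ (x, y) * Real.exp (-t * ρ (x, y)))
          * Real.exp (aFn (fun y => ρ (x, y)) Q t)) := by
      intro y
      rw [← ENNReal.ofReal_mul (Real.exp_pos _).le]
      congr 1
      rw [Real.exp_add]
      ring
    simp_rw [this]
    rw [← ofReal_integral_eq_lintegral_ofReal (hi.mul_const _)
      (ae_of_all _ fun y => mul_nonneg (mul_nonneg (hρ0 _) (Real.exp_pos _).le)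
        (Real.exp_pos _).le), integral_mul_const, hGa]
    rfl
  have hρi : Integrable ρ W := by
    rw [← lintegral_ofReal_ne_top_iff_integrable hρm.aestronglyMeasurable (ae_of_all _ hρ0), hρW]
    exact ENNReal.ofReal_ne_top
  have hρI : ∫ z, ρ z ∂W = D := by
    rw [integral_eq_lintegral_of_nonneg_ae (ae_of_all _ hρ0) hρm.aestronglyMeasurable, hρW,
      ENNReal.toReal_ofReal hD0]
  have hai : Integrable (fun z : S × T => aFn (fun y => ρ (z.1, y)) Q t) W := by
    have h5 := hint t ht.le
    rw [← hWm] at h5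
    exact h5.comp_measurable measurable_fst
  have haI : ∫ z, aFn (fun y => ρ (z.1, y)) Q t ∂W = ∫ x, aFn (fun y => ρ (x, y)) Q t ∂P := by
    conv_rhs => rw [← hWm]
    rw [integral_map measurable_fst.aemeasurable (a_meas hρm t).aestronglyMeasurable]
  refine ⟨W, ⟨hWp, hWm, ?_⟩, ?_⟩
  · rw [hρW, EReal.coe_ennreal_ofReal, max_eq_left hD0]
  · rw [hWe (fun z => -t * ρ z + aFn (fun y => ρ (z.1, y)) Q t)
      (ae_of_all _ fun z => Real.log_exp _) ((hρi.const_mul _).add hai),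
      integral_add (hρi.const_mul _) hai, integral_const_mul, hρI, haI]
    congr 1
    ring

/-- The product coupling, when the optimum is at zero. -/
lemma case_zero (hρm : Measurable ρ) (hρ0 : ∀ z, 0 ≤ ρ z) {D : ℝ}
    (hint : ∀ t, 0 ≤ t → Integrable (fun x => aFn (fun y => ρ (x, y)) Q t) P)
    (hmax : ∀ s, 0 ≤ s → (∫ x, aFn (fun y => ρ (x, y)) Q s ∂P) - s * D ≤ 0) :
    ∃ W ∈ distSet ρ P D, relEnt W (P.prod Q) = 0 := by
  obtain ⟨W, hW, hWp, hWm, hWl, hWe⟩ := constr (P := P) (Q := Q) (f := fun _ => 1)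
    measurable_const (fun z => zero_le_one) (ae_of_all _ fun x => by simp)
  have hD0 : 0 ≤ D := by
    have h1 := hmax 1 zero_le_one
    have h2 : 0 ≤ ∫ x, aFn (fun y => ρ (x, y)) Q 1 ∂P :=
      integral_nonneg fun x => pt_nonneg (sec_meas hρm x) (fun y => hρ0 (x, y)) zero_le_one
    linarith
  have hb : ∫⁻ z, ENNReal.ofReal (ρ z) ∂W ≤ ENNReal.ofReal D := by
    set F : ℕ → S × T → ℝ :=
      fun n z => ((n : ℝ) + 1) * (1 - Real.exp (-(1 / ((n : ℝ) + 1)) * ρ z)) with hF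
    have hFm : ∀ n, Measurable (F n) := fun n => by
      simp only [hF]; fun_prop
    have hlim : ∀ z, Tendsto (fun n => ENNReal.ofReal (F n z)) atTop
        (𝓝 (ENNReal.ofReal (ρ z))) := by
      intro z
      apply (ENNReal.continuous_ofReal.tendsto _).comp
      have hd : HasDerivAt (fun u : ℝ => 1 - Real.exp (-u * ρ z)) (ρ z) 0 := by
        have h := (((hasDerivAt_id (0 : ℝ)).neg.mul_const (ρ z)).exp).const_sub 1
        simpa using h
      have hs := hd.tendsto_slope_zero
      have hseq : Tendsto (fun n : ℕ => 1 / ((n : ℝ) + 1)) atTop (𝓝[≠] 0) := by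
        rw [tendsto_nhdsWithin_iff]
        refine ⟨tendsto_one_div_add_atTop_nhds_zero_nat, Eventually.of_forall fun n => ?_⟩
        have : (0 : ℝ) < 1 / ((n : ℝ) + 1) := by positivity
        exact this.ne'
      refine (hs.comp hseq).congr fun n => ?_
      simp [hF]
    have hFle : ∀ n, ∫⁻ z, ENNReal.ofReal (F n z) ∂W ≤ ENNReal.ofReal D := by
      intro n
      have hn : (0 : ℝ) < 1 / ((n : ℝ) + 1) := by positivity
      have hn1 : (0 : ℝ) < (n : ℝ) + 1 := by positivity
      have hnn : ∀ x, 0 ≤ aFn (fun y => ρ (x, y)) Q (1 / ((n : ℝ) + 1)) :=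
        fun x => pt_nonneg (sec_meas hρm x) (fun y => hρ0 (x, y)) hn.le
      rw [hWl _ (hFm n).ennreal_ofReal]
      calc _ ≤ ∫⁻ x, ENNReal.ofReal
              (((n : ℝ) + 1) * aFn (fun y => ρ (x, y)) Q (1 / ((n : ℝ) + 1))) ∂P := by
            apply lintegral_mono
            intro x
            have hi := pt_int (Q := Q) (sec_meas hρm x) (fun y => hρ0 (x, y)) hn.le
            simp only [ENNReal.ofReal_one, one_mul]
            have hFi : Integrable (fun y => F n (x, y)) Q :=
              ((integrable_const 1).sub hi).const_mul _
            rw [← ofReal_integral_eq_lintegral_ofReal hFi (ae_of_all _ fun y => ?_)]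
            · apply ENNReal.ofReal_le_ofReal
              simp only [hF]
              rw [integral_const_mul, integral_sub (integrable_const _) hi,
                ← pt_exp (sec_meas hρm x) (fun y => hρ0 (x, y)) hn.le]
              apply mul_le_mul_of_nonneg_left _ hn1.le
              have := Real.add_one_le_exp (-aFn (fun y => ρ (x, y)) Q (1 / ((n : ℝ) + 1)))
              simp only [integral_const, probReal_univ, one_smul]
              linarith
            · apply mul_nonneg hn1.le
              have : Real.exp (-(1 / ((n : ℝ) + 1)) * ρ (x, y)) ≤ 1 := by
                apply Real.exp_le_one_iff.2
                nlinarith [hρ0 (x, y)]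
              simpa using this
        _ = ENNReal.ofReal (((n : ℝ) + 1) *
              ∫ x, aFn (fun y => ρ (x, y)) Q (1 / ((n : ℝ) + 1)) ∂P) := by
            rw [← ofReal_integral_eq_lintegral_ofReal ((hint _ hn.le).const_mul _)
              (ae_of_all _ fun x => mul_nonneg hn1.le (hnn x)), integral_const_mul]
        _ ≤ ENNReal.ofReal D := by
            apply ENNReal.ofReal_le_ofReal
            have h := hmax _ hn.le
            have h2 := mul_le_mul_of_nonneg_left (sub_nonpos.1 h) hn1.le
            refine h2.trans (le_of_eq ?_)
            field_simp
    calc ∫⁻ z, ENNReal.ofReal (ρ z) ∂W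
        = ∫⁻ z, liminf (fun n => ENNReal.ofReal (F n z)) atTop ∂W :=
          lintegral_congr fun z => (hlim z).liminf_eq.symm
      _ ≤ liminf (fun n => ∫⁻ z, ENNReal.ofReal (F n z) ∂W) atTop :=
          lintegral_liminf_le fun n => (hFm n).ennreal_ofReal
      _ ≤ liminf (fun _ : ℕ => ENNReal.ofReal D) atTop :=
          liminf_le_liminf (Eventually.of_forall hFle)
      _ = ENNReal.ofReal D := liminf_const _
  refine ⟨W, ⟨hWp, hWm, ?_⟩, ?_⟩
  · refine (EReal.coe_ennreal_le_coe_ennreal_iff.2 hb).trans (le_of_eq ?_)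
    rw [EReal.coe_ennreal_ofReal, max_eq_left hD0]
  · rw [hWe (fun _ => 0) (ae_of_all _ fun z => Real.log_one) (integrable_zero _ _ _)]
    simp

end Prod

section Final

variable {S T : Type*} [MeasurableSpace S] [MeasurableSpace T]
  {ρ : S × T → ℝ} {P : Measure S} {Q : Measure T} [IsProbabilityMeasure P] [IsProbabilityMeasure Q]

/-- Conditioning on the essential minimum, when the supremum is only reached at infinity. -/
lemma case_lim (hρm : Measurable ρ) (hρ0 : ∀ z, 0 ≤ ρ z) {D M : ℝ}
    (hint : ∀ t, 0 ≤ t → Integrable (fun x => aFn (fun y => ρ (x, y)) Q t) P)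
    (hlub : IsLUB ((fun t => (∫ x, aFn (fun y => ρ (x, y)) Q t ∂P) - t * D) '' Ici 0) M)
    (hlow : ∀ n : ℕ, ((n : ℝ) + 1) * D ≤ ∫ x, aFn (fun y => ρ (x, y)) Q ((n : ℝ) + 1) ∂P) :
    ∃ W ∈ distSet ρ P D, relEnt W (P.prod Q) = ENNReal.ofReal M := by
  set a : ℝ → S → ℝ := fun t x => aFn (fun y => ρ (x, y)) Q t with ha
  set r : S → ℝ := fun x => rFn (fun y => ρ (x, y)) Q with hr
  have hX := fun x => sec_meas hρm x
  have h0 : ∀ x y, 0 ≤ ρ (x, y) := fun x y => hρ0 (x, y)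
  have hrm : Measurable r := r_meas hρm
  have hr0 : ∀ x, 0 ≤ r x := fun x => pt_r_nonneg (hX x) (h0 x)
  have hle : ∀ t, 0 ≤ t → (∫ x, a t x ∂P) - t * D ≤ M := fun t ht => hlub.1 ⟨t, ht, rfl⟩
  have hri : Integrable r P := by
    refine (hint 1 zero_le_one).mono' hrm.aestronglyMeasurable (ae_of_all _ fun x => ?_)
    rw [Real.norm_eq_abs, abs_of_nonneg (hr0 x)]
    have := pt_r_le (Q := Q) (hX x) (h0 x) 0
    simpa using this
  have hrD : ∫ x, r x ∂P = D := by
    have h1 : Tendsto (fun n : ℕ => ∫ x, a ((n : ℝ) + 1) x / ((n : ℝ) + 1) ∂P) atTop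
        (𝓝 (∫ x, r x ∂P)) := by
      refine tendsto_integral_of_dominated_convergence (a 1)
        (fun n => ((a_meas hρm _).div_const _).aestronglyMeasurable) (hint 1 zero_le_one) ?_
        (ae_of_all _ fun x => pt_r_tendsto (hX x) (h0 x))
      intro n
      refine ae_of_all _ fun x => ?_
      have hn : (0 : ℝ) ≤ n := by positivity
      rw [Real.norm_eq_abs, abs_of_nonneg
        (div_nonneg (pt_nonneg (hX x) (h0 x) (by positivity)) (by positivity))]
      have := pt_anti (Q := Q) (hX x) (h0 x) one_pos (show (1 : ℝ) ≤ (n : ℝ) + 1 by linarith)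
      simpa using this
    have h2 : Tendsto (fun n : ℕ => D + M * (1 / ((n : ℝ) + 1))) atTop (𝓝 D) := by
      have := (tendsto_one_div_add_atTop_nhds_zero_nat (𝕜 := ℝ)).const_mul M |>.const_add D
      simpa using this
    have h3 : Tendsto (fun n : ℕ => ∫ x, a ((n : ℝ) + 1) x / ((n : ℝ) + 1) ∂P) atTop (𝓝 D) := by
      refine tendsto_of_tendsto_of_tendsto_of_le_of_le tendsto_const_nhds h2 ?_ ?_
      · intro n
        have hn : (0 : ℝ) < (n : ℝ) + 1 := by positivity
        simp only
        rw [integral_div, le_div_iff₀ hn, mul_comm]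
        exact hlow n
      · intro n
        have hn : (0 : ℝ) < (n : ℝ) + 1 := by positivity
        simp only
        rw [integral_div, div_le_iff₀ hn]
        have := hle _ hn.le
        have h5 : (D + M * (1 / ((n : ℝ) + 1))) * ((n : ℝ) + 1) = ((n : ℝ) + 1) * D + M := by
          field_simp
        rw [h5]
        linarith
    exact tendsto_nhds_unique h1 h3
  have hD0 : 0 ≤ D := hrD ▸ integral_nonneg hr0
  set A : Set (S × T) := {z | ρ z = r z.1} with hA
  have hAm : MeasurableSet A := measurableSet_eq_fun hρm (hrm.comp measurable_fst)
  set q : S → ℝ := fun x => Q.real {y | ρ (x, y) = r x} with hq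
  have hqm : Measurable q := (measurable_measure_prodMk_left (ν := Q) hAm).ennreal_toReal
  have hq1 : ∀ x, q x ≤ 1 := fun x => measureReal_le_one
  have hq0 : ∀ x, 0 ≤ q x := fun x => measureReal_nonneg
  set b : ℕ → S → ℝ := fun n x => a ((n : ℝ) + 1) x - ((n : ℝ) + 1) * r x with hb
  have hbm : ∀ n, Measurable (b n) := fun n => (a_meas hρm _).sub (hrm.const_mul _)
  have hb0 : ∀ n x, 0 ≤ b n x := fun n x => sub_nonneg.2 (pt_r_le (hX x) (h0 x) n)
  have hbI : ∀ n, ∫⁻ x, ENNReal.ofReal (b n x) ∂P ≤ ENNReal.ofReal M := by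
    intro n
    have hn : (0 : ℝ) ≤ (n : ℝ) + 1 := by positivity
    have hbi : Integrable (b n) P := (hint _ hn).sub (hri.const_mul _)
    rw [← ofReal_integral_eq_lintegral_ofReal hbi (ae_of_all _ (hb0 n))]
    apply ENNReal.ofReal_le_ofReal
    simp only [hb]
    rw [integral_sub (hint _ hn) (hri.const_mul _), integral_const_mul, hrD]
    exact hle _ hn
  have hfat : ∫⁻ x, liminf (fun n => ENNReal.ofReal (b n x)) atTop ∂P ≤ ENNReal.ofReal M :=
    calc _ ≤ liminf (fun n => ∫⁻ x, ENNReal.ofReal (b n x) ∂P) atTop :=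
          lintegral_liminf_le fun n => (hbm n).ennreal_ofReal
      _ ≤ liminf (fun _ : ℕ => ENNReal.ofReal M) atTop :=
          liminf_le_liminf (Eventually.of_forall hbI)
      _ = ENNReal.ofReal M := liminf_const _
  have hlimexp : ∀ x, Tendsto (fun n => Real.exp (-(b n x))) atTop (𝓝 (q x)) :=
    fun x => pt_lim (hX x) (h0 x)
  have hfinae : ∀ᵐ x ∂P, liminf (fun n => ENNReal.ofReal (b n x)) atTop < ∞ :=
    ae_lt_top (Measurable.liminf fun n => (hbm n).ennreal_ofReal)
      (ne_top_of_le_ne_top ENNReal.ofReal_ne_top hfat)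
  have hqpos : ∀ᵐ x ∂P, 0 < q x := by
    filter_upwards [hfinae] with x hx
    refine lt_of_le_of_ne (hq0 x) fun hqx => ?_
    have h1 := hlimexp x
    rw [← hqx] at h1
    have h2 : Tendsto (fun n => b n x) atTop atTop := by
      have := tendsto_neg_atBot_atTop.comp (Real.tendsto_exp_comp_nhds_zero.1 h1)
      exact this.congr fun n => by simp
    have h3 := ENNReal.tendsto_ofReal_atTop.comp h2
    exact hx.ne h3.liminf_eq
  have hl0 : ∀ x, 0 ≤ -Real.log (q x) :=
    fun x => neg_nonneg.2 (Real.log_nonpos (hq0 x) (hq1 x))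
  have hlm : Measurable fun x => -Real.log (q x) := (Real.measurable_log.comp hqm).neg
  have hlI : ∫⁻ x, ENNReal.ofReal (-Real.log (q x)) ∂P ≤ ENNReal.ofReal M := by
    refine le_trans (le_of_eq (lintegral_congr_ae ?_)) hfat
    filter_upwards [hqpos] with x hx
    have h1 := ((Real.continuousAt_log hx.ne').tendsto.comp (hlimexp x)).neg
    have h2 : Tendsto (fun n => b n x) atTop (𝓝 (-Real.log (q x))) :=
      h1.congr fun n => by simp
    exact (((ENNReal.continuous_ofReal.tendsto _).comp h2).liminf_eq).symm
  have hli : Integrable (fun x => -Real.log (q x)) P := by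
    rw [← lintegral_ofReal_ne_top_iff_integrable hlm.aestronglyMeasurable (ae_of_all _ hl0)]
    exact ne_top_of_le_ne_top ENNReal.ofReal_ne_top hlI
  have hM0 : 0 ≤ M := by
    have := hle 0 le_rfl
    simpa [ha, pt_zero] using this
  have hlM : ∫ x, -Real.log (q x) ∂P = M := by
    apply le_antisymm
    · rw [← ofReal_integral_eq_lintegral_ofReal hli (ae_of_all _ hl0)] at hlI
      exact (ENNReal.ofReal_le_ofReal_iff hM0).1 hlI
    · apply hlub.2
      rintro _ ⟨t, ht, rfl⟩
      have h1 : ∫ x, a t x ∂P ≤ ∫ x, (t * r x + -Real.log (q x)) ∂P := by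
        apply integral_mono_ae (hint t ht) ((hri.const_mul _).add hli)
        filter_upwards [hqpos] with x hx
        exact pt_upper (hX x) (h0 x) hx ht
      rw [integral_add (hri.const_mul _) hli, integral_const_mul, hrD] at h1
      simp only
      linarith
  -- the coupling
  set f : S × T → ℝ := A.indicator fun z => (q z.1)⁻¹ with hf
  have hfm : Measurable f := (hqm.comp measurable_fst).inv.indicator hAm
  have hf0 : ∀ z, 0 ≤ f z := fun z => indicator_nonneg (fun z _ => inv_nonneg.2 (hq0 z.1)) z
  have hsl : ∀ x, MeasurableSet {y | ρ (x, y) = r x} := fun x =>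
    (hX x) (measurableSet_singleton _)
  have hfs : ∀ x y, ENNReal.ofReal (f (x, y))
      = {y | ρ (x, y) = r x}.indicator (fun _ => ENNReal.ofReal (q x)⁻¹) y := by
    intro x y
    by_cases hy : ρ (x, y) = r x
    · simp [hf, hA, indicator, hy]
    · simp [hf, hA, indicator, hy]
  have hf1 : ∀ᵐ x ∂P, ∫⁻ y, ENNReal.ofReal (f (x, y)) ∂Q = 1 := by
    filter_upwards [hqpos] with x hx
    simp_rw [hfs]
    rw [lintegral_indicator_const (hsl x)]
    have : Q {y | ρ (x, y) = r x} = ENNReal.ofReal (q x) := by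
      simp [hq, Measure.real]
    rw [this, ← ENNReal.ofReal_mul (inv_nonneg.2 (hq0 x)), inv_mul_cancel₀ hx.ne',
      ENNReal.ofReal_one]
  obtain ⟨W, hW, hWp, hWm, hWl, hWe⟩ := constr (P := P) (Q := Q) hfm hf0 hf1
  have hWA : ∀ᵐ z ∂W, z ∈ A := by
    rw [hW, ae_withDensity_iff hfm.ennreal_ofReal]
    refine ae_of_all _ fun z hz => ?_
    by_contra hzA
    apply hz
    simp [hf, hzA]
  have hρW : ∫⁻ z, ENNReal.ofReal (ρ z) ∂W = ENNReal.ofReal D := by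
    have h1 : ∫⁻ z, ENNReal.ofReal (ρ z) ∂W = ∫⁻ z, ENNReal.ofReal (r z.1) ∂W := by
      apply lintegral_congr_ae
      filter_upwards [hWA] with z hz
      rw [show ρ z = r z.1 from hz]
    rw [h1, ← lintegral_map (f := fun x => ENNReal.ofReal (r x)) hrm.ennreal_ofReal
      measurable_fst, hWm, ← ofReal_integral_eq_lintegral_ofReal hri (ae_of_all _ hr0), hrD]
  have hLi : Integrable (fun z : S × T => -Real.log (q z.1)) W := by
    have h5 := hli
    rw [← hWm] at h5
    exact h5.comp_measurable measurable_fst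
  have hLI : ∫ z, -Real.log (q z.1) ∂W = M := by
    rw [← hlM]
    conv_rhs => rw [← hWm]
    rw [integral_map measurable_fst.aemeasurable hlm.aestronglyMeasurable]
  refine ⟨W, ⟨hWp, hWm, ?_⟩, ?_⟩
  · rw [hρW, EReal.coe_ennreal_ofReal, max_eq_left hD0]
  · rw [hWe (fun z => -Real.log (q z.1)) ?_ hLi, hLI]
    filter_upwards [hWA] with z hz
    simp [hf, hz, Real.log_inv]

end Final

/-- if `Λ*(P,Q,D) < ∞`, then there is a `W ∈ W(P,D)` with
`H(W‖P×Q) = Λ*(P,Q,D)`. -/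
theorem stmt3 {S T : Type*} [MeasurableSpace S] [StandardBorelSpace S]
    [MeasurableSpace T] [StandardBorelSpace T]
    (ρ : S × T → ℝ) (hρm : Measurable ρ) (hρ0 : ∀ z, 0 ≤ ρ z)
    (P : Measure S) (Q : Measure T) [IsProbabilityMeasure P] [IsProbabilityMeasure Q]
    (D : ℝ) (hfin : LamStar ρ P Q D ≠ ⊤) :
    ∃ W ∈ distSet ρ P D, ((relEnt W (P.prod Q) : ℝ≥0∞) : EReal) = LamStar ρ P Q D := by
  obtain ⟨M, hM, hint, hlub⟩ := lamstar_lub hρm hρ0 hfin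
  have hM0 : 0 ≤ M := by
    have := hlub.1 ⟨0, self_mem_Ici, rfl⟩
    simpa [pt_zero] using this
  suffices h : ∃ W ∈ distSet ρ P D, relEnt W (P.prod Q) = ENNReal.ofReal M by
    obtain ⟨W, hW, hE⟩ := h
    exact ⟨W, hW, by rw [hE, hM, EReal.coe_ennreal_ofReal, max_eq_left hM0]⟩
  by_cases hlow : ∀ n : ℕ, ((n : ℝ) + 1) * D ≤ ∫ x, aFn (fun y => ρ (x, y)) Q ((n : ℝ) + 1) ∂P
  · exact case_lim hρm hρ0 hint hlub hlow
  push Not at hlow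
  obtain ⟨n, hn⟩ := hlow
  have hN : (0 : ℝ) < (n : ℝ) + 1 := by positivity
  have hcont : ContinuousOn (fun t => (∫ x, aFn (fun y => ρ (x, y)) Q t ∂P) - t * D)
      (Icc 0 ((n : ℝ) + 1)) := by
    refine ContinuousOn.sub ?_ (by fun_prop)
    refine continuousOn_of_dominated (bound := fun x => aFn (fun y => ρ (x, y)) Q ((n : ℝ) + 1))
      (fun t _ => (a_meas hρm t).aestronglyMeasurable) ?_ (hint _ hN.le)
      (ae_of_all _ fun x => (pt_cont (sec_meas hρm x) fun y => hρ0 (x, y)).mono Icc_subset_Ici_self)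
    intro t ht
    refine ae_of_all _ fun x => ?_
    rw [Real.norm_eq_abs, abs_of_nonneg (pt_nonneg (sec_meas hρm x) (fun y => hρ0 (x, y)) ht.1)]
    exact pt_mono (sec_meas hρm x) (fun y => hρ0 (x, y)) ht.1 ht.2
  obtain ⟨t, ht, hmax⟩ := isCompact_Icc.exists_isMaxOn (nonempty_Icc.2 hN.le) hcont
  have hval0 : (∫ x, aFn (fun y => ρ (x, y)) Q 0 ∂P) - 0 * D = 0 := by simp [pt_zero]
  have hmax' : ∀ s, 0 ≤ s → (∫ x, aFn (fun y => ρ (x, y)) Q s ∂P) - s * D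
      ≤ (∫ x, aFn (fun y => ρ (x, y)) Q t ∂P) - t * D := by
    intro s hs
    rcases le_total s ((n : ℝ) + 1) with hsn | hsn
    · exact hmax ⟨hs, hsn⟩
    · have h0 := hmax (show (0 : ℝ) ∈ Icc 0 ((n : ℝ) + 1) from ⟨le_rfl, hN.le⟩)
      have h0' : (∫ x, aFn (fun y => ρ (x, y)) Q 0 ∂P) - 0 * D
        ≤ (∫ x, aFn (fun y => ρ (x, y)) Q t ∂P) - t * D := h0
      rw [hval0] at h0'
      refine le_trans ?_ h0'
      have hs0 : 0 < s := hN.trans_le hsn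
      have h1 : ∫ x, aFn (fun y => ρ (x, y)) Q s / s ∂P
          ≤ ∫ x, aFn (fun y => ρ (x, y)) Q ((n : ℝ) + 1) / ((n : ℝ) + 1) ∂P :=
        integral_mono ((hint s hs).div_const _) ((hint _ hN.le).div_const _)
          fun x => pt_anti (sec_meas hρm x) (fun y => hρ0 (x, y)) hN hsn
      rw [integral_div, integral_div] at h1
      have h2 : (∫ x, aFn (fun y => ρ (x, y)) Q ((n : ℝ) + 1) ∂P) / ((n : ℝ) + 1) < D := by
        rw [div_lt_iff₀ hN]; linarith
      have h3 := h1.trans h2.le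
      rw [div_le_iff₀ hs0] at h3
      linarith
  have hMt : M = (∫ x, aFn (fun y => ρ (x, y)) Q t ∂P) - t * D := by
    apply le_antisymm
    · apply hlub.2
      rintro _ ⟨s, hs, rfl⟩
      exact hmax' s hs
    · exact hlub.1 ⟨t, ht.1, rfl⟩
  rcases ht.1.eq_or_lt with h0 | hpos
  · subst h0
    rw [hval0] at hMt hmax'
    rw [hMt, ENNReal.ofReal_zero]
    exact case_zero hρm hρ0 hint hmax'
  · rw [hMt]
    exact case_pos hρm hρ0 hint hpos hmax'

end
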